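/- Let n ≥ 2 and let G ⊆ ℝⁿ be a bounded subregion. Then for every L ∈ [0, Per(G)) there exists a Lebesgue measurable set E ⊆ cl(G) with Per(E) = L such that Lⁿ(E') ≤ Lⁿ(E) for every measurable E' ⊆ cl(G) with Per(E') = L. -/

import Mathlib

open MeasureTheory
open scoped ENNReal

/-- The divergence of a vector field on `ℝⁿ`. -/
noncomputable def vecDiv {n : ℕ} (φ : EuclideanSpace ℝ (Fin n) → EuclideanSpace ℝ (Fin n))
    (x : EuclideanSpace ℝ (Fin n)) : ℝ :=
  ∑ i : Fin n, fderiv ℝ φ x (EuclideanSpace.single i 1) i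

/-- The perimeter of a set `E` relative to an open set `F`:
`Per(E;F) = sup { ∫_E div φ dx : φ ∈ C¹_0(F, ℝⁿ), |φ| ≤ 1 }`. -/
noncomputable def perIn {n : ℕ} (E F : Set (EuclideanSpace ℝ (Fin n))) : ℝ≥0∞ :=
  ⨆ φ : {φ : EuclideanSpace ℝ (Fin n) → EuclideanSpace ℝ (Fin n) //
      ContDiff ℝ 1 φ ∧ HasCompactSupport φ ∧ tsupport φ ⊆ F ∧ ∀ x, ‖φ x‖ ≤ 1},
    ENNReal.ofReal (∫ x in E, vecDiv φ.1 x)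

/-- The perimeter of `E` (relative to all of `ℝⁿ`). -/
noncomputable def per {n : ℕ} (E : Set (EuclideanSpace ℝ (Fin n))) : ℝ≥0∞ :=
  perIn E Set.univ

section Perimeter

open Filter Topology Set Metric

section Divergence

variable {n : ℕ}

theorem per_le_iff {E : Set (EuclideanSpace ℝ (Fin n))} {L : ℝ≥0∞} :
    per E ≤ L ↔ ∀ φ : EuclideanSpace ℝ (Fin n) → EuclideanSpace ℝ (Fin n), ContDiff ℝ 1 φ →
      HasCompactSupport φ → (∀ x, ‖φ x‖ ≤ 1) → ENNReal.ofReal (∫ x in E, vecDiv φ x) ≤ L := by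
  simp only [per, perIn, iSup_le_iff, Subtype.forall]
  exact ⟨fun h φ h1 h2 h3 => h φ ⟨h1, h2, subset_univ _, h3⟩,
    fun h φ hφ => h φ hφ.1 hφ.2.1 hφ.2.2.2⟩

theorem per_congr_ae {E F : Set (EuclideanSpace ℝ (Fin n))} (h : E =ᵐ[volume] F) :
    per E = per F := by
  simp only [per, perIn, setIntegral_congr_set h]

theorem vecDiv_smul {g : EuclideanSpace ℝ (Fin n) → ℝ}
    {φ : EuclideanSpace ℝ (Fin n) → EuclideanSpace ℝ (Fin n)} {x : EuclideanSpace ℝ (Fin n)}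
    (hg : DifferentiableAt ℝ g x) (hφ : DifferentiableAt ℝ φ x) :
    vecDiv (fun y => g y • φ y) x = g x * vecDiv φ x + fderiv ℝ g x (φ x) := by
  have key : fderiv ℝ g x (φ x) =
      ∑ i, φ x i * fderiv ℝ g x (EuclideanSpace.single i 1) := by
    conv_lhs => rw [← (EuclideanSpace.basisFun (Fin n) ℝ).sum_repr (φ x)]
    simp
  rw [key, vecDiv, vecDiv, Finset.mul_sum, ← Finset.sum_add_distrib, fderiv_fun_smul hg hφ]
  refine Finset.sum_congr rfl fun i _ => ?_
  simp [mul_comm]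

theorem vecDiv_smul_const {g : EuclideanSpace ℝ (Fin n) → ℝ} (v : EuclideanSpace ℝ (Fin n))
    {x : EuclideanSpace ℝ (Fin n)} (hg : DifferentiableAt ℝ g x) :
    vecDiv (fun y => g y • v) x = fderiv ℝ g x v := by
  rw [vecDiv_smul hg (differentiableAt_const v)]
  simp [vecDiv]

theorem continuous_vecDiv {φ : EuclideanSpace ℝ (Fin n) → EuclideanSpace ℝ (Fin n)}
    (hφ : ContDiff ℝ 1 φ) : Continuous (vecDiv φ) := by
  have := hφ.continuous_fderiv one_ne_zero
  unfold vecDiv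
  fun_prop

theorem hasCompactSupport_vecDiv {φ : EuclideanSpace ℝ (Fin n) → EuclideanSpace ℝ (Fin n)}
    (hφ : HasCompactSupport φ) : HasCompactSupport (vecDiv φ) := by
  refine (hφ.fderiv ℝ).mono' ?_
  refine (Function.support_subset_iff'.2 fun x hx => ?_).trans (subset_tsupport _)
  simp [vecDiv, Function.notMem_support.1 hx]

theorem integrable_vecDiv {φ : EuclideanSpace ℝ (Fin n) → EuclideanSpace ℝ (Fin n)}
    (hφ : ContDiff ℝ 1 φ) (hc : HasCompactSupport φ) : Integrable (vecDiv φ) :=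
  (continuous_vecDiv hφ).integrable_of_hasCompactSupport (hasCompactSupport_vecDiv hc)

theorem integral_vecDiv_eq_zero {φ : EuclideanSpace ℝ (Fin n) → EuclideanSpace ℝ (Fin n)}
    (hφ : ContDiff ℝ 1 φ) (hc : HasCompactSupport φ) : ∫ x, vecDiv φ x = 0 := by
  have hd := hφ.differentiable one_ne_zero
  have hcont := hφ.continuous_fderiv one_ne_zero
  have hint : ∀ v, Integrable (fun x => fderiv ℝ φ x v) := fun v =>
    (hcont.clm_apply continuous_const).integrable_of_hasCompactSupport (hc.fderiv_apply ℝ v)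
  have hv : ∀ v, ∫ x, fderiv ℝ φ x v = 0 := fun v => by
    have := integral_smul_fderiv_eq_neg_fderiv_smul_of_integrable (μ := volume)
      (f := fun _ => (1 : ℝ)) (g := φ) (v := v) (by simp) (by simpa using hint v)
      (by simpa using hφ.continuous.integrable_of_hasCompactSupport hc)
      (fun _ _ => differentiableAt_const _) (fun x _ => hd x)
    simpa using this
  have hpr : ∀ (v : EuclideanSpace ℝ (Fin n)) (i : Fin n),
      Integrable (fun x => fderiv ℝ φ x v i) ∧ ∫ x, fderiv ℝ φ x v i = 0 := fun v i => by
    refine ⟨(EuclideanSpace.proj (𝕜 := ℝ) i).integrable_comp (hint v), ?_⟩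
    have := (EuclideanSpace.proj (𝕜 := ℝ) i).integral_comp_comm (hint v)
    simpa [hv v] using this
  unfold vecDiv
  rw [integral_finsetSum _ fun i _ => (hpr _ i).1]
  exact Finset.sum_eq_zero fun i _ => (hpr _ i).2

theorem setIntegral_vecDiv_le {E : Set (EuclideanSpace ℝ (Fin n))} (hE : per E ≠ ⊤)
    {φ : EuclideanSpace ℝ (Fin n) → EuclideanSpace ℝ (Fin n)}
    (hφ : ContDiff ℝ 1 φ) (hc : HasCompactSupport φ) (hb : ∀ x, ‖φ x‖ ≤ 1) :
    ∫ x in E, vecDiv φ x ≤ (per E).toReal :=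
  (ENNReal.ofReal_le_iff_le_toReal hE).1 (per_le_iff.1 le_rfl φ hφ hc hb)

theorem setIntegral_vecDiv_le_mul {E : Set (EuclideanSpace ℝ (Fin n))} (hE : per E ≠ ⊤)
    {φ : EuclideanSpace ℝ (Fin n) → EuclideanSpace ℝ (Fin n)} {c : ℝ}
    (hφ : ContDiff ℝ 1 φ) (hc : HasCompactSupport φ) (hb : ∀ x, ‖φ x‖ ≤ c) (hc0 : 0 < c) :
    ∫ x in E, vecDiv φ x ≤ c * (per E).toReal := by
  have h := setIntegral_vecDiv_le hE (φ := fun x => c⁻¹ • φ x) (hφ.const_smul _)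
    (hc.smul_left (f := fun _ => c⁻¹)) (fun x => by
      rw [norm_smul, norm_inv, Real.norm_of_nonneg hc0.le, inv_mul_le_iff₀ hc0]
      simpa using hb x)
  have hdiv : vecDiv (fun x => c⁻¹ • φ x) = fun x => c⁻¹ * vecDiv φ x := by
    ext x
    rw [vecDiv_smul (g := fun _ => c⁻¹) (differentiableAt_const _)
      (hφ.differentiable one_ne_zero x)]
    simp
  rwa [hdiv, integral_const_mul, inv_mul_le_iff₀ hc0] at h

theorem integral_vecDiv_interpolation_le {E : Set (EuclideanSpace ℝ (Fin n))}
    (hEm : MeasurableSet E) (hE : per E ≠ ⊤) {v : EuclideanSpace ℝ (Fin n) → ℝ}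
    (hv : ContDiff ℝ 1 v) (hvc : HasCompactSupport v) (hv0 : ∀ x, 0 ≤ v x) (hv1 : ∀ x, v x ≤ 1)
    {φ : EuclideanSpace ℝ (Fin n) → EuclideanSpace ℝ (Fin n)}
    (hφ : ContDiff ℝ 1 φ) (hc : HasCompactSupport φ) (hb : ∀ x, ‖φ x‖ ≤ 1) :
    ∫ x, (E.indicator 1 x + v x - E.indicator 1 x * v x) * vecDiv φ x ≤
      (per E).toReal + ∫ x, ‖fderiv ℝ v x‖ := by
  have hvd := hv.differentiable one_ne_zero
  have hφd := hφ.differentiable one_ne_zero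
  have hvcont := hv.continuous_fderiv one_ne_zero
  have hone : ContDiff ℝ 1 (fun x => 1 - v x) := contDiff_const.sub hv
  have h1 := setIntegral_vecDiv_le hE (φ := fun x => (1 - v x) • φ x) (hone.smul hφ)
    (hc.smul_left (f := fun x => 1 - v x)) (fun x => by
      rw [norm_smul, Real.norm_of_nonneg (by linarith [hv1 x])]
      exact mul_le_one₀ (by linarith [hv0 x]) (norm_nonneg _) (hb x))
  have h2 : ∫ x, vecDiv (fun x => v x • φ x) x = 0 :=
    integral_vecDiv_eq_zero (hv.smul hφ) (hc.smul_left (f := v))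
  have hi : Integrable (fun x => fderiv ℝ v x (φ x)) :=
    (hvcont.clm_apply hφ.continuous).integrable_of_hasCompactSupport
      (hc.mono' ((Function.support_subset_iff'.2 fun x hx => by
        simp [Function.notMem_support.1 hx]).trans (subset_tsupport φ)))
  have hnorm : Integrable (fun x => ‖fderiv ℝ v x‖) :=
    (hvcont.integrable_of_hasCompactSupport (hvc.fderiv ℝ)).norm
  have hd1 : Integrable (fun x => E.indicator (vecDiv fun x => (1 - v x) • φ x) x) :=
    (integrable_vecDiv (hone.smul hφ) (hc.smul_left (f := fun x => 1 - v x))).indicator hEm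
  have hd2 : Integrable (fun x => vecDiv (fun x => v x • φ x) x) :=
    integrable_vecDiv (hv.smul hφ) (hc.smul_left (f := v))
  rw [← integral_indicator hEm] at h1
  have hpt : ∀ x, (E.indicator 1 x + v x - E.indicator 1 x * v x) * vecDiv φ x =
      E.indicator (vecDiv fun x => (1 - v x) • φ x) x + vecDiv (fun x => v x • φ x) x
        - Eᶜ.indicator (fun x => fderiv ℝ v x (φ x)) x := fun x => by
    have e1 := vecDiv_smul (hone.differentiable one_ne_zero x) (hφd x)
    have e2 := vecDiv_smul (hvd x) (hφd x)
    rw [fderiv_const_sub, neg_apply] at e1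
    by_cases hx : x ∈ E
    · simp only [indicator_of_mem hx, Pi.one_apply, e1, e2,
        indicator_of_notMem (notMem_compl_iff.2 hx)]
      ring
    · simp only [indicator_of_notMem hx, e2, indicator_of_mem (mem_compl hx)]
      ring
  have h3 : -∫ x, Eᶜ.indicator (fun x => fderiv ℝ v x (φ x)) x ≤ ∫ x, ‖fderiv ℝ v x‖ := by
    rw [← integral_neg]
    refine integral_mono (hi.indicator hEm.compl).neg hnorm fun x => ?_
    refine (neg_le_abs _).trans ?_
    rw [← Real.norm_eq_abs]
    refine (norm_indicator_le_norm_self _ _).trans ?_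
    exact (ContinuousLinearMap.le_opNorm_of_le _ (hb x)).trans_eq (mul_one _)
  simp only [hpt]
  rw [integral_sub (by exact hd1.add hd2) (hi.indicator hEm.compl), integral_add hd1 hd2]
  linarith

end Divergence

section Ball

variable {n : ℕ}

theorem Real.smoothTransition.deriv_eq_zero {t : ℝ} (ht : t < 0 ∨ 1 < t) :
    deriv Real.smoothTransition t = 0 := by
  rcases ht with ht | ht
  · have : Real.smoothTransition =ᶠ[𝓝 t] fun _ => 0 := by
      filter_upwards [Iio_mem_nhds ht] with s hs
      exact Real.smoothTransition.zero_of_nonpos (le_of_lt hs)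
    rw [this.deriv_eq, deriv_const]
  · have : Real.smoothTransition =ᶠ[𝓝 t] fun _ => 1 := by
      filter_upwards [Ioi_mem_nhds ht] with s hs
      exact Real.smoothTransition.one_of_one_le (le_of_lt hs)
    rw [this.deriv_eq, deriv_const]

theorem Real.smoothTransition.exists_norm_deriv_le :
    ∃ C, 0 ≤ C ∧ ∀ t, ‖deriv Real.smoothTransition t‖ ≤ C := by
  have hc : HasCompactSupport (deriv Real.smoothTransition) :=
    HasCompactSupport.intro (isCompact_Icc (a := (0 : ℝ)) (b := 1)) fun t ht =>
      Real.smoothTransition.deriv_eq_zero (by simpa [or_iff_not_imp_left] using ht)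
  obtain ⟨C, hC⟩ := (Real.smoothTransition.contDiff (n := 1)).continuous_deriv_one
    |>.bounded_above_of_compact_support hc
  exact ⟨C, (norm_nonneg _).trans (hC 0), hC⟩

/-- A smooth radial function which is `1` on the closed ball of radius `r` about `c` and vanishes
outside the ball of radius `ρ`. -/
noncomputable def radialCutoff (c : EuclideanSpace ℝ (Fin n)) (r ρ : ℝ)
    (x : EuclideanSpace ℝ (Fin n)) : ℝ :=
  1 - Real.smoothTransition ((‖x - c‖ ^ 2 - r ^ 2) / (ρ ^ 2 - r ^ 2))

theorem radialCutoff_nonneg (c : EuclideanSpace ℝ (Fin n)) (r ρ : ℝ)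
    (x : EuclideanSpace ℝ (Fin n)) : 0 ≤ radialCutoff c r ρ x :=
  sub_nonneg.2 (Real.smoothTransition.le_one _)

theorem radialCutoff_le_one (c : EuclideanSpace ℝ (Fin n)) (r ρ : ℝ)
    (x : EuclideanSpace ℝ (Fin n)) : radialCutoff c r ρ x ≤ 1 :=
  sub_le_self _ (Real.smoothTransition.nonneg _)

theorem radialCutoff_eq_one {c x : EuclideanSpace ℝ (Fin n)} {r ρ : ℝ} (hr : 0 < r)
    (hρ : r < ρ) (hx : ‖x - c‖ ≤ r) : radialCutoff c r ρ x = 1 := by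
  have h1 : r ^ 2 < ρ ^ 2 := by gcongr
  have h2 : ‖x - c‖ ^ 2 ≤ r ^ 2 := by gcongr
  rw [radialCutoff, Real.smoothTransition.zero_of_nonpos, sub_zero]
  exact div_nonpos_of_nonpos_of_nonneg (by linarith) (by linarith)

theorem radialCutoff_eq_zero {c x : EuclideanSpace ℝ (Fin n)} {r ρ : ℝ} (hr : 0 < r)
    (hρ : r < ρ) (hx : ρ ≤ ‖x - c‖) : radialCutoff c r ρ x = 0 := by
  have hρ0 : 0 < ρ := hr.trans hρ
  have h1 : r ^ 2 < ρ ^ 2 := by gcongr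
  have h2 : ρ ^ 2 ≤ ‖x - c‖ ^ 2 := by gcongr
  rw [radialCutoff, Real.smoothTransition.one_of_one_le, sub_self]
  rw [one_le_div (by linarith)]
  linarith

theorem contDiff_radialCutoff (c : EuclideanSpace ℝ (Fin n)) (r ρ : ℝ) :
    ContDiff ℝ 1 (radialCutoff c r ρ) := by
  refine contDiff_const.sub ((Real.smoothTransition.contDiff (n := 1)).comp ?_)
  exact (((contDiff_id.sub contDiff_const).norm_sq ℝ).sub contDiff_const).div_const _

theorem hasCompactSupport_radialCutoff (c : EuclideanSpace ℝ (Fin n)) {r ρ : ℝ} (hr : 0 < r)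
    (hρ : r < ρ) : HasCompactSupport (radialCutoff c r ρ) :=
  HasCompactSupport.intro (isCompact_closedBall c ρ) fun x hx =>
    radialCutoff_eq_zero hr hρ (by
      rw [mem_closedBall, dist_eq_norm] at hx
      exact (not_le.1 hx).le)

theorem norm_fderiv_radialCutoff_le {C : ℝ}
    (hC0 : 0 ≤ C) (hC : ∀ t, ‖deriv Real.smoothTransition t‖ ≤ C)
    (c x : EuclideanSpace ℝ (Fin n)) {r ρ : ℝ} (hr : 0 < r) (hρ : r < ρ) :
    ‖fderiv ℝ (radialCutoff c r ρ) x‖ ≤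
      (closedBall c ρ \ ball c r).indicator (fun _ => 2 * C * ρ / (ρ ^ 2 - r ^ 2)) x := by
  have h1 : 0 < ρ ^ 2 - r ^ 2 := by
    have : r ^ 2 < ρ ^ 2 := by gcongr
    linarith
  have hd : HasFDerivAt (radialCutoff c r ρ)
      (-(deriv Real.smoothTransition ((‖x - c‖ ^ 2 - r ^ 2) / (ρ ^ 2 - r ^ 2)) •
        ((ρ ^ 2 - r ^ 2)⁻¹ • (2 • innerSL ℝ (x - c))))) x := by
    have hst := ((Real.smoothTransition.contDiff (n := 1)).differentiable one_ne_zero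
      ((‖x - c‖ ^ 2 - r ^ 2) / (ρ ^ 2 - r ^ 2))).hasDerivAt
    have hsq := ((hasStrictFDerivAt_norm_sq (x - c)).hasFDerivAt.comp x
      ((hasFDerivAt_id x).sub_const c)).sub_const (r ^ 2) |>.const_smul ((ρ ^ 2 - r ^ 2)⁻¹)
    have hsq' : HasFDerivAt (fun y => (‖y - c‖ ^ 2 - r ^ 2) / (ρ ^ 2 - r ^ 2))
        ((ρ ^ 2 - r ^ 2)⁻¹ • (2 • innerSL ℝ (x - c))) x := by
      refine (hsq.congr_of_eventuallyEq (Eventually.of_forall fun y => ?_)).congr_fderiv ?_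
      · simp [div_eq_inv_mul]
      · ext; simp
    exact (hst.comp_hasFDerivAt x hsq').const_sub 1
  rw [hd.fderiv, norm_neg, norm_smul]
  by_cases hx : x ∈ closedBall c ρ \ ball c r
  · rw [indicator_of_mem hx, norm_smul, norm_inv, Real.norm_of_nonneg h1.le, two_smul]
    have h2 : ‖innerSL ℝ (x - c) + innerSL ℝ (x - c)‖ ≤ 2 * ρ := by
      refine (norm_add_le _ _).trans ?_
      rw [innerSL_apply_norm]
      have := hx.1
      rw [mem_closedBall, dist_eq_norm] at this
      linarith
    calc _ ≤ C * ((ρ ^ 2 - r ^ 2)⁻¹ * (2 * ρ)) := by gcongr; exact hC _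
      _ = _ := by field_simp
  · rw [indicator_of_notMem hx, Real.smoothTransition.deriv_eq_zero]
    · simp
    · rw [Set.mem_sdiff, not_and_or, not_not, mem_closedBall, mem_ball, dist_eq_norm, not_le] at hx
      rcases hx with hx | hx
      · right
        rw [one_lt_div h1]
        have hρ0 : 0 < ρ := hr.trans hρ
        have : ρ ^ 2 < ‖x - c‖ ^ 2 := by gcongr
        linarith
      · left
        have : ‖x - c‖ ^ 2 < r ^ 2 := by gcongr
        exact div_neg_of_neg_of_pos (by linarith) h1

theorem integral_norm_fderiv_radialCutoff_le {C : ℝ}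
    (hC0 : 0 ≤ C) (hC : ∀ t, ‖deriv Real.smoothTransition t‖ ≤ C)
    (c : EuclideanSpace ℝ (Fin n)) {r ρ : ℝ} (hr : 0 < r) (hρ : r < ρ) (hρ2 : ρ ≤ 2 * r) :
    ∫ x, ‖fderiv ℝ (radialCutoff c r ρ) x‖ ≤
      2 * C * n * volume.real (ball (0 : EuclideanSpace ℝ (Fin n)) 1) * (2 * r) ^ (n - 1) := by
  set κ := volume.real (ball (0 : EuclideanSpace ℝ (Fin n)) 1)
  have hκ : 0 ≤ κ := measureReal_nonneg
  have h1 : 0 < ρ ^ 2 - r ^ 2 := by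
    have : r ^ 2 < ρ ^ 2 := by gcongr
    linarith
  have hsub : ball c r ⊆ closedBall c ρ :=
    ball_subset_closedBall.trans (closedBall_subset_closedBall hρ.le)
  have hms : MeasurableSet (closedBall c ρ \ ball c r) :=
    measurableSet_closedBall.diff measurableSet_ball
  have hvol : volume.real (closedBall c ρ \ ball c r) = (ρ ^ n - r ^ n) * κ := by
    rw [measureReal_sdiff hsub measurableSet_ball measure_closedBall_lt_top.ne,
      Measure.addHaar_real_closedBall _ _ (hr.trans hρ).le,
      measureReal_def _ (ball c r), Measure.addHaar_ball_of_pos _ _ hr, ENNReal.toReal_mul,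
      ENNReal.toReal_ofReal (by positivity), ← measureReal_def]
    simp only [finrank_euclideanSpace, Fintype.card_fin]
    ring
  have hpow : ρ ^ n - r ^ n ≤ (ρ - r) * n * ρ ^ (n - 1) := by
    have := abs_pow_sub_pow_le ρ r n
    rw [abs_of_pos (sub_pos.2 hρ), abs_of_pos hr, abs_of_pos (hr.trans hρ),
      max_eq_left hρ.le] at this
    exact (le_abs_self _).trans this
  have hρ0 : 0 < ρ := hr.trans hρ
  calc ∫ x, ‖fderiv ℝ (radialCutoff c r ρ) x‖
      ≤ ∫ x, (closedBall c ρ \ ball c r).indicator (fun _ => 2 * C * ρ / (ρ ^ 2 - r ^ 2)) x := by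
        refine integral_mono_of_nonneg (Eventually.of_forall fun _ => norm_nonneg _) ?_
          (Eventually.of_forall fun x => norm_fderiv_radialCutoff_le hC0 hC c x hr hρ)
        exact (integrable_indicator_iff hms).2 (integrableOn_const
          ((measure_mono sdiff_subset).trans_lt measure_closedBall_lt_top).ne)
    _ = (ρ ^ n - r ^ n) * κ * (2 * C * ρ / (ρ ^ 2 - r ^ 2)) := by
        rw [integral_indicator hms, setIntegral_const, hvol, smul_eq_mul]
    _ ≤ ((ρ - r) * n * ρ ^ (n - 1)) * κ * (2 * C * ρ / (ρ ^ 2 - r ^ 2)) := by gcongr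
    _ = (2 * C * n * κ * ρ ^ (n - 1)) * (ρ / (ρ + r)) := by
        have : ρ - r ≠ 0 := (sub_pos.2 hρ).ne'
        rw [sq_sub_sq]
        field_simp
    _ ≤ (2 * C * n * κ * ρ ^ (n - 1)) * 1 := by
        gcongr
        rw [div_le_one (by linarith)]
        linarith
    _ ≤ 2 * C * n * κ * (2 * r) ^ (n - 1) := by
        rw [mul_one]
        gcongr

theorem exists_per_union_closedBall_le (n : ℕ) : ∃ C : ℝ, 0 ≤ C ∧
    ∀ (E : Set (EuclideanSpace ℝ (Fin n))) (c : EuclideanSpace ℝ (Fin n)) (r : ℝ),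
      MeasurableSet E → 0 < r →
      per (E ∪ closedBall c r) ≤ per E + ENNReal.ofReal (C * r ^ (n - 1)) := by
  obtain ⟨C, hC0, hC⟩ := Real.smoothTransition.exists_norm_deriv_le
  refine ⟨2 * C * n * volume.real (ball (0 : EuclideanSpace ℝ (Fin n)) 1) * 2 ^ (n - 1),
    by positivity, fun E c r hEm hr => ?_⟩
  by_cases hE : per E = ⊤
  · simp [hE]
  set D := 2 * C * n * volume.real (ball (0 : EuclideanSpace ℝ (Fin n)) 1) * 2 ^ (n - 1)
  refine per_le_iff.2 fun φ hφ hc hb => ?_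
  rw [← ENNReal.ofReal_toReal hE, ← ENNReal.ofReal_add (by simp) (by positivity)]
  refine ENNReal.ofReal_le_ofReal ?_
  set ρ : ℕ → ℝ := fun j => r + r * (1 / ((j : ℝ) + 1))
  have hρ : ∀ j, r < ρ j := fun j => lt_add_of_pos_right _ (by positivity)
  have hρ2 : ∀ j, ρ j ≤ 2 * r := fun j => by
    have : 1 / ((j : ℝ) + 1) ≤ 1 := by
      rw [div_le_one (by positivity)]
      linarith [j.cast_nonneg (α := ℝ)]
    simp only [ρ]
    nlinarith
  have hρt : Tendsto ρ atTop (𝓝 r) := by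
    simpa [ρ] using (tendsto_one_div_add_atTop_nhds_zero_nat (𝕜 := ℝ)).const_mul r |>.const_add r
  have hle : ∀ j, ∫ x, (E.indicator 1 x + radialCutoff c r (ρ j) x
      - E.indicator 1 x * radialCutoff c r (ρ j) x) * vecDiv φ x ≤
      (per E).toReal + D * r ^ (n - 1) := fun j => by
    refine (integral_vecDiv_interpolation_le hEm hE (contDiff_radialCutoff c r _)
      (hasCompactSupport_radialCutoff c hr (hρ j)) (radialCutoff_nonneg c r _)
      (radialCutoff_le_one c r _) hφ hc hb).trans ?_
    have := integral_norm_fderiv_radialCutoff_le hC0 hC c hr (hρ j) (hρ2 j)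
    rw [mul_pow] at this
    simp only [D]
    linarith
  have hlim : Tendsto (fun j => ∫ x, (E.indicator 1 x + radialCutoff c r (ρ j) x
      - E.indicator 1 x * radialCutoff c r (ρ j) x) * vecDiv φ x) atTop
      (𝓝 (∫ x, (E ∪ closedBall c r).indicator (vecDiv φ) x)) := by
    refine tendsto_integral_of_dominated_convergence (fun x => ‖vecDiv φ x‖) (fun j => ?_)
      (integrable_vecDiv hφ hc).norm (fun j => Eventually.of_forall fun x => ?_)
      (Eventually.of_forall fun x => ?_)
    · have h1 : Measurable (E.indicator (1 : EuclideanSpace ℝ (Fin n) → ℝ)) :=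
        measurable_one.indicator hEm
      have h2 := (contDiff_radialCutoff c r (ρ j)).continuous.measurable
      exact (((h1.add h2).sub (h1.mul h2)).mul
        (continuous_vecDiv hφ).measurable).aestronglyMeasurable
    · rw [norm_mul]
      refine mul_le_of_le_one_left (norm_nonneg _) ?_
      have h0 := radialCutoff_nonneg c r (ρ j) x
      have h1 := radialCutoff_le_one c r (ρ j) x
      rw [Real.norm_eq_abs, abs_le]
      by_cases hx : x ∈ E
      · simp [indicator_of_mem hx]
      · simp only [indicator_of_notMem hx]
        constructor <;> linarith
    · refine tendsto_const_nhds.congr' ?_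
      by_cases hx : x ∈ closedBall c r
      · refine Eventually.of_forall fun j => ?_
        have := hx
        rw [mem_closedBall, dist_eq_norm] at this
        simp only
        rw [radialCutoff_eq_one hr (hρ j) this, indicator_of_mem (mem_union_right _ hx)]
        ring
      · have hx' := hx
        rw [mem_closedBall, dist_eq_norm, not_le] at hx'
        filter_upwards [hρt.eventually_le_const hx'] with j hj
        rw [radialCutoff_eq_zero hr (hρ j) hj]
        by_cases hxE : x ∈ E
        · simp [hxE]
        · simp [hxE, hx]
  rw [← integral_indicator (hEm.union measurableSet_closedBall)]
  exact le_of_tendsto' hlim hle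

end Ball

section Compactness

variable {n : ℕ}

theorem indicator_one_mem_Icc {α : Type*} (E : Set α) (x : α) :
    E.indicator (1 : α → ℝ) x ∈ Icc (0 : ℝ) 1 := by
  by_cases hx : x ∈ E <;> simp [hx]

theorem integral_translate_sub_mul_le {E : Set (EuclideanSpace ℝ (Fin n))}
    (hEm : MeasurableSet E) (hEfin : volume E ≠ ⊤) (hE : per E ≠ ⊤)
    {ψ : EuclideanSpace ℝ (Fin n) → ℝ} (hψ : ContDiff ℝ 1 ψ) (hc : HasCompactSupport ψ)
    (hb : ∀ x, ‖ψ x‖ ≤ 1) (h : EuclideanSpace ℝ (Fin n)) :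
    ∫ x, (E.indicator 1 (x + h) - E.indicator 1 x) * ψ x ≤ ‖h‖ * (per E).toReal := by
  rcases eq_or_ne h 0 with rfl | h0
  · simp
  have hψd := hψ.differentiable one_ne_zero
  have hψ' := hψ.continuous_fderiv one_ne_zero
  obtain ⟨C, hC⟩ := hψ'.bounded_above_of_compact_support (hc.fderiv ℝ)
  have htr : ∀ t : ℝ, ContDiff ℝ 1 (fun x => ψ (x - t • h)) := fun t =>
    hψ.comp (contDiff_id.sub contDiff_const)
  have htc : ∀ t : ℝ, HasCompactSupport (fun x => ψ (x - t • h)) := fun t =>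
    hc.comp_homeomorph (Homeomorph.subRight (t • h))
  have hint : ∀ t : ℝ, Integrable (fun x => ψ (x - t • h)) := fun t =>
    (htr t).continuous.integrable_of_hasCompactSupport (htc t)
  have hder : ∀ t : ℝ, HasDerivAt (fun t : ℝ => ∫ x in E, ψ (x - t • h))
      (∫ x in E, fderiv ℝ ψ (x - t • h) (-h)) t := fun t => by
    refine (hasDerivAt_integral_of_dominated_loc_of_deriv_le (s := univ)
      (μ := volume.restrict E) (F := fun (s : ℝ) x => ψ (x - s • h))
      (F' := fun (s : ℝ) x => fderiv ℝ ψ (x - s • h) (-h)) (bound := fun _ => C * ‖h‖)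
      univ_mem (Eventually.of_forall fun s => (hint s).aestronglyMeasurable.restrict)
      (hint t).integrableOn ?_ ?_ ?_ ?_).2
    · exact ((hψ'.comp (continuous_id.sub continuous_const)).clm_apply
        continuous_const).aestronglyMeasurable
    · refine Eventually.of_forall fun x s _ => ?_
      refine (ContinuousLinearMap.le_opNorm _ _).trans ?_
      rw [norm_neg]
      gcongr
      exact hC _
    · exact integrableOn_const hEfin
    · refine Eventually.of_forall fun x s _ => ?_
      have h1 : HasDerivAt (fun s : ℝ => x - s • h) (-h) s := by
        simpa using ((hasDerivAt_id s).smul_const h).const_sub x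
      exact (hψd _).hasFDerivAt.comp_hasDerivAt s h1
  have hle : ∀ t : ℝ, deriv (fun t : ℝ => ∫ x in E, ψ (x - t • h)) t ≤
      ‖h‖ * (per E).toReal := fun t => by
    rw [(hder t).deriv]
    have := setIntegral_vecDiv_le_mul hE (φ := fun x => ψ (x - t • h) • (-h)) (c := ‖h‖)
      ((htr t).smul contDiff_const) ((htc t).smul_right (f' := fun _ => -h)) (fun x => by
        rw [norm_smul, norm_neg]
        exact mul_le_of_le_one_left (norm_nonneg _) (hb _)) (norm_pos_iff.2 h0)
    refine le_of_eq_of_le (integral_congr_ae (Eventually.of_forall fun x => ?_)) this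
    simp only
    rw [vecDiv_smul_const _ ((htr t).differentiable one_ne_zero x), fderiv_comp_sub]
  have hmv := image_sub_le_mul_sub_of_deriv_le (fun t => (hder t).differentiableAt) hle
    zero_le_one
  have e1 : ∫ x, (E.indicator 1 (x + h) - E.indicator 1 x) * ψ x =
      (∫ x in E, ψ (x - (1 : ℝ) • h)) - ∫ x in E, ψ (x - (0 : ℝ) • h) := by
    rw [← integral_indicator hEm, ← integral_indicator hEm,
      ← integral_add_right_eq_self (fun x => E.indicator (fun x => ψ (x - (1 : ℝ) • h)) x) h,
      ← integral_sub (((hint 1).indicator hEm).comp_add_right h) ((hint 0).indicator hEm)]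
    refine integral_congr_ae (Eventually.of_forall fun x => ?_)
    by_cases h1 : x + h ∈ E <;> by_cases h2 : x ∈ E <;> simp [h1, h2]
  rw [e1]
  simpa using hmv

theorem exists_mollification {g : EuclideanSpace ℝ (Fin n) → ℝ} (hg : Integrable g)
    (hgc : HasCompactSupport g) (hgb : ∀ x, ‖g x‖ ≤ 1) :
    ∃ ψ : ℕ → EuclideanSpace ℝ (Fin n) → ℝ, (∀ j, ContDiff ℝ 1 (ψ j)) ∧
      (∀ j, HasCompactSupport (ψ j)) ∧ (∀ j x, ‖ψ j x‖ ≤ 1) ∧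
      ∀ᵐ x, Tendsto (fun j => ψ j x) atTop (𝓝 (g x)) := by
  let b : ℕ → ContDiffBump (0 : EuclideanSpace ℝ (Fin n)) := fun j =>
    ⟨1 / ((j : ℝ) + 1), 2 * (1 / ((j : ℝ) + 1)), by positivity,
      lt_mul_of_one_lt_left (by positivity) one_lt_two⟩
  refine ⟨fun j => convolution ((b j).normed volume) g (ContinuousLinearMap.lsmul ℝ ℝ) volume,
    fun j => ?_, fun j => ?_, fun j x => ?_, ?_⟩
  · exact (b j).hasCompactSupport_normed.contDiff_convolution_left _ (b j).contDiff_normed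
      hg.locallyIntegrable
  · exact (b j).hasCompactSupport_normed.convolution _ hgc
  · rw [← dist_zero_right]
    refine dist_convolution_le zero_le_one (b j).support_normed_eq.subset
      (fun x => (b j).nonneg_normed x) (b j).integral_normed hg.aestronglyMeasurable
      (fun y _ => by simpa using hgb y)
  · refine ContDiffBump.ae_convolution_tendsto_right_of_locallyIntegrable (K := 2) ?_
      (Eventually.of_forall fun j => le_rfl) hg.locallyIntegrable
    simpa [b] using (tendsto_one_div_add_atTop_nhds_zero_nat (𝕜 := ℝ)).const_mul 2

theorem lintegral_enorm_translate_sub_le {E : Set (EuclideanSpace ℝ (Fin n))}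
    (hEm : MeasurableSet E) (hEb : Bornology.IsBounded E) (hE : per E ≠ ⊤)
    (h : EuclideanSpace ℝ (Fin n)) :
    ∫⁻ x, ‖E.indicator (1 : EuclideanSpace ℝ (Fin n) → ℝ) x - E.indicator 1 (x + h)‖ₑ ≤
      ENNReal.ofReal (‖h‖ * (per E).toReal) := by
  have hEfin : volume E ≠ ⊤ := hEb.measure_lt_top.ne
  set f : EuclideanSpace ℝ (Fin n) → ℝ := E.indicator 1 with hf
  have hfi : Integrable f := (integrable_indicator_iff hEm).2 (integrableOn_const hEfin)
  have hfc : HasCompactSupport f :=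
    HasCompactSupport.intro hEb.isCompact_closure fun x hx =>
      indicator_of_notMem (fun h => hx (subset_closure h)) _
  set g : EuclideanSpace ℝ (Fin n) → ℝ := fun x => f (x + h) - f x with hg
  have hgi : Integrable g := (hfi.comp_add_right h).sub hfi
  have hgc : HasCompactSupport g := (hfc.comp_homeomorph (Homeomorph.addRight h)).sub hfc
  have hgb : ∀ x, ‖g x‖ ≤ 1 := fun x => by
    have h1 := indicator_one_mem_Icc E (x + h)
    have h2 := indicator_one_mem_Icc E x
    rw [Real.norm_eq_abs, abs_le]
    constructor <;> simp only [hg, hf] <;> linarith [h1.1, h1.2, h2.1, h2.2]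
  have hgg : ∀ x, g x * g x = ‖g x‖ := fun x => by
    by_cases h1 : x + h ∈ E <;> by_cases h2 : x ∈ E <;> simp [hg, hf, h1, h2]
  obtain ⟨ψ, hψ1, hψ2, hψ3, hψ4⟩ := exists_mollification hgi hgc hgb
  have hlim : Tendsto (fun j => ∫ x, g x * ψ j x) atTop (𝓝 (∫ x, g x * g x)) := by
    refine tendsto_integral_of_dominated_convergence (fun x => ‖g x‖) (fun j => ?_) hgi.norm
      (fun j => Eventually.of_forall fun x => ?_) ?_
    · exact hgi.aestronglyMeasurable.mul (hψ1 j).continuous.aestronglyMeasurable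
    · rw [norm_mul]
      exact mul_le_of_le_one_right (norm_nonneg _) (hψ3 j x)
    · filter_upwards [hψ4] with x hx using hx.const_mul _
  have hle := le_of_tendsto' hlim fun j =>
    integral_translate_sub_mul_le hEm hEfin hE (hψ1 j) (hψ2 j) (hψ3 j) h
  simp only [hgg] at hle
  have : ∫⁻ x, ‖f x - f (x + h)‖ₑ = ENNReal.ofReal (∫ x, ‖g x‖) := by
    rw [ofReal_integral_norm_eq_lintegral_enorm hgi]
    refine lintegral_congr fun x => ?_
    rw [← enorm_neg, neg_sub]
  rw [this]
  exact ENNReal.ofReal_le_ofReal hle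

/-- The proportion of the ball of radius `δ` about `x` which is occupied by `E`. -/
noncomputable def ballDensity (E : Set (EuclideanSpace ℝ (Fin n))) (δ : ℝ)
    (x : EuclideanSpace ℝ (Fin n)) : ℝ :=
  (volume.real (ball (0 : EuclideanSpace ℝ (Fin n)) δ))⁻¹ * volume.real (E ∩ ball x δ)

theorem volume_real_ball_pos (x : EuclideanSpace ℝ (Fin n)) {δ : ℝ} (hδ : 0 < δ) :
    0 < volume.real (ball x δ) :=
  ENNReal.toReal_pos (measure_ball_pos volume _ hδ).ne' measure_ball_lt_top.ne

theorem ballDensity_eq {E : Set (EuclideanSpace ℝ (Fin n))} (hEm : MeasurableSet E) (δ : ℝ)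
    (x : EuclideanSpace ℝ (Fin n)) :
    ballDensity E δ x = (volume.real (ball (0 : EuclideanSpace ℝ (Fin n)) δ))⁻¹ *
      ∫ y in ball 0 δ, E.indicator 1 (x + y) := by
  rw [ballDensity]
  congr 1
  have h1 : (fun y => (ball 0 δ).indicator (fun y => E.indicator (1 : EuclideanSpace ℝ (Fin n) → ℝ) (x + y)) y) =
      fun y => (E ∩ ball x δ).indicator (1 : EuclideanSpace ℝ (Fin n) → ℝ) (x + y) := by
    ext y
    by_cases h1 : x + y ∈ E <;> by_cases h2 : ‖y‖ < δ <;>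
      simp [indicator, h1, h2, mem_ball, dist_eq_norm]
  rw [← integral_indicator measurableSet_ball, h1,
    integral_add_left_eq_self (fun z => (E ∩ ball x δ).indicator (1 : EuclideanSpace ℝ (Fin n) → ℝ) z) x,
    integral_indicator_one (hEm.inter measurableSet_ball)]

theorem measurable_ballDensity {E : Set (EuclideanSpace ℝ (Fin n))} (hEm : MeasurableSet E)
    (δ : ℝ) : Measurable (ballDensity E δ) := by
  have hf : Measurable (fun p : EuclideanSpace ℝ (Fin n) × EuclideanSpace ℝ (Fin n) =>
      E.indicator (1 : EuclideanSpace ℝ (Fin n) → ℝ) (p.1 + p.2)) :=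
    (measurable_one.indicator hEm).comp (measurable_fst.add measurable_snd)
  have h1 : Measurable fun x => ∫ y in ball 0 δ, E.indicator (1 : EuclideanSpace ℝ (Fin n) → ℝ) (x + y) :=
    (hf.stronglyMeasurable.integral_prod_right'
      (ν := volume.restrict (ball (0 : EuclideanSpace ℝ (Fin n)) δ))).measurable
  rw [funext (ballDensity_eq hEm δ)]
  exact h1.const_mul _

theorem ballDensity_mem_Icc (E : Set (EuclideanSpace ℝ (Fin n))) {δ : ℝ} (hδ : 0 < δ)
    (x : EuclideanSpace ℝ (Fin n)) : ballDensity E δ x ∈ Icc (0 : ℝ) 1 := by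
  have h1 : volume.real (ball x δ) = volume.real (ball (0 : EuclideanSpace ℝ (Fin n)) δ) := by
    rw [measureReal_def, measureReal_def, Measure.addHaar_ball_center]
  refine ⟨mul_nonneg (inv_nonneg.2 measureReal_nonneg) measureReal_nonneg, ?_⟩
  rw [ballDensity, inv_mul_le_iff₀ (volume_real_ball_pos _ hδ), mul_one, ← h1]
  exact measureReal_mono inter_subset_right measure_ball_lt_top.ne

theorem ballDensity_eq_zero {E : Set (EuclideanSpace ℝ (Fin n))} {R δ : ℝ}
    (hE : E ⊆ closedBall 0 R) {x : EuclideanSpace ℝ (Fin n)} (hx : x ∉ closedBall 0 (R + δ)) :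
    ballDensity E δ x = 0 := by
  have : E ∩ ball x δ = ∅ := by
    refine eq_empty_of_forall_notMem fun y hy => hx ?_
    have h1 := mem_closedBall.1 (hE hy.1)
    have h2 := mem_ball'.1 hy.2
    rw [mem_closedBall]
    linarith [dist_triangle x y 0]
  simp [ballDensity, this]

theorem lintegral_enorm_sub_ballDensity_le {E : Set (EuclideanSpace ℝ (Fin n))}
    (hEm : MeasurableSet E) (hEb : Bornology.IsBounded E) (hE : per E ≠ ⊤) {δ : ℝ}
    (hδ : 0 < δ) :
    ∫⁻ x, ‖E.indicator (1 : EuclideanSpace ℝ (Fin n) → ℝ) x - ballDensity E δ x‖ₑ ≤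
      ENNReal.ofReal (δ * (per E).toReal) := by
  set f : EuclideanSpace ℝ (Fin n) → ℝ := E.indicator 1 with hf
  set B := ball (0 : EuclideanSpace ℝ (Fin n)) δ
  have hκ : 0 < volume.real B := volume_real_ball_pos _ hδ
  have hBfin : volume B ≠ ⊤ := measure_ball_lt_top.ne
  have hfm : Measurable f := measurable_one.indicator hEm
  have hfi : Integrable f := (integrable_indicator_iff hEm).2
    (integrableOn_const hEb.measure_lt_top.ne)
  have hm : Measurable (fun p : EuclideanSpace ℝ (Fin n) × EuclideanSpace ℝ (Fin n) =>
      ‖f p.1 - f (p.1 + p.2)‖ₑ) :=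
    ((hfm.comp measurable_fst).sub (hfm.comp (measurable_fst.add measurable_snd))).enorm
  have hpt : ∀ x, ‖f x - ballDensity E δ x‖ₑ ≤
      ENNReal.ofReal (volume.real B)⁻¹ * ∫⁻ y in B, ‖f x - f (x + y)‖ₑ := fun x => by
    have e : f x - ballDensity E δ x =
        (volume.real B)⁻¹ * ∫ y in B, (f x - f (x + y)) := by
      rw [ballDensity_eq hEm, integral_sub (integrable_const_iff.2 (Or.inr ⟨by simpa using hBfin.lt_top⟩))
        (hfi.comp_add_left x).integrableOn, setIntegral_const, smul_eq_mul, mul_sub,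
        inv_mul_cancel_left₀ hκ.ne']
    rw [e, enorm_mul, Real.enorm_of_nonneg (inv_nonneg.2 hκ.le)]
    gcongr
    exact enorm_integral_le_lintegral_enorm _
  calc ∫⁻ x, ‖f x - ballDensity E δ x‖ₑ
      ≤ ∫⁻ x, ENNReal.ofReal (volume.real B)⁻¹ * ∫⁻ y in B, ‖f x - f (x + y)‖ₑ :=
        lintegral_mono hpt
    _ = ENNReal.ofReal (volume.real B)⁻¹ * ∫⁻ y in B, ∫⁻ x, ‖f x - f (x + y)‖ₑ := by
        rw [lintegral_const_mul _ hm.lintegral_prod_right', lintegral_lintegral_swap hm.aemeasurable]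
    _ ≤ ENNReal.ofReal (volume.real B)⁻¹ *
          ∫⁻ y in B, ENNReal.ofReal (δ * (per E).toReal) := by
        refine mul_le_mul_right ?_ _
        refine setLIntegral_mono measurable_const fun y hy => ?_
        refine (lintegral_enorm_translate_sub_le hEm hEb hE y).trans ?_
        refine ENNReal.ofReal_le_ofReal ?_
        gcongr
        exact (mem_ball_zero_iff.1 hy).le
    _ = ENNReal.ofReal (δ * (per E).toReal) := by
        rw [setLIntegral_const, mul_comm (ENNReal.ofReal (δ * _)), ← mul_assoc,
          ← ENNReal.ofReal_toReal hBfin, ← measureReal_def, ← ENNReal.ofReal_mul (by positivity),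
          inv_mul_cancel₀ hκ.ne', ENNReal.ofReal_one, one_mul]

/-- Uniformly bounded sequences of sets have weakly convergent subsequences. -/
theorem exists_subseq_tendsto_measureReal_inter
    {E : ℕ → Set (EuclideanSpace ℝ (Fin n))} (hEm : ∀ k, MeasurableSet (E k)) {R : ℝ}
    (hER : ∀ k, E k ⊆ closedBall 0 R) :
    ∃ σ : ℕ → ℕ, StrictMono σ ∧ ∀ B : Set (EuclideanSpace ℝ (Fin n)), MeasurableSet B →
      volume B ≠ ⊤ → ∃ l, Tendsto (fun k => volume.real (E (σ k) ∩ B)) atTop (𝓝 l) := by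
  have hfin : ∀ k, volume (E k) ≠ ⊤ := fun k =>
    ((measure_mono (hER k)).trans_lt measure_closedBall_lt_top).ne
  have : Fact ((2 : ℝ≥0∞) ≠ ⊤) := ⟨by simp⟩
  let u : ℕ → Lp ℝ 2 (volume : Measure (EuclideanSpace ℝ (Fin n))) := fun k =>
    indicatorConstLp 2 (hEm k) (hfin k) (1 : ℝ)
  let M := volume.real (closedBall (0 : EuclideanSpace ℝ (Fin n)) R) ^ (1 / (2 : ℝ≥0∞).toReal)
  have hu : ∀ k, ‖u k‖ ≤ M := fun k => by
    simp only [u]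
    rw [norm_indicatorConstLp (by simp) (by simp), norm_one, one_mul]
    refine Real.rpow_le_rpow measureReal_nonneg ?_ (by positivity)
    exact measureReal_mono (hER k) measure_closedBall_lt_top.ne
  obtain ⟨T, -, σ, hσ, hT⟩ := WeakDual.isSeqCompact_closedBall ℝ _ 0 M
    (x := fun k => StrongDual.toWeakDual (innerSL ℝ (u k))) (fun k => by
      simpa [innerSL_apply_norm] using hu k)
  refine ⟨σ, hσ, fun B hB hBfin => ⟨T (indicatorConstLp 2 hB hBfin (1 : ℝ)), ?_⟩⟩
  have := (WeakDual.eval_continuous (𝕜 := ℝ) (indicatorConstLp 2 hB hBfin (1 : ℝ))).tendsto T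
    |>.comp hT
  refine this.congr fun k => ?_
  exact L2.real_inner_indicatorConstLp_one_indicatorConstLp_one (hEm _) hB (hfin _) hBfin

theorem exists_tendsto_lintegral_enorm_sub {f : ℕ → EuclideanSpace ℝ (Fin n) → ℝ}
    (hf : ∀ k, Measurable (f k)) (hf01 : ∀ k x, f k x ∈ Icc (0 : ℝ) 1) {R : ℝ}
    (hf0 : ∀ k, ∀ x ∉ closedBall 0 R, f k x = 0)
    (hlim : ∀ x, ∃ l, Tendsto (fun k => f k x) atTop (𝓝 l)) :
    ∃ a : EuclideanSpace ℝ (Fin n) → ℝ,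
      Measurable a ∧ Tendsto (fun k => ∫⁻ x, ‖f k x - a x‖ₑ) atTop (𝓝 0) := by
  choose a ha using hlim
  have ham : Measurable a := measurable_of_tendsto_metrizable hf (tendsto_pi_nhds.2 ha)
  have ha01 : ∀ x, a x ∈ Icc (0 : ℝ) 1 := fun x =>
    isClosed_Icc.mem_of_tendsto (ha x) (Eventually.of_forall fun k => hf01 k x)
  have ha0 : ∀ x ∉ closedBall 0 R, a x = 0 := fun x hx =>
    tendsto_nhds_unique (ha x) (by simp [hf0 _ x hx])
  refine ⟨a, ham, ?_⟩
  have key : Tendsto (fun k => ∫⁻ x, ‖f k x - a x‖ₑ) atTop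
      (𝓝 (∫⁻ _ : EuclideanSpace ℝ (Fin n), 0)) := by
    refine tendsto_lintegral_of_dominated_convergence ((closedBall 0 R).indicator 1)
      (fun k => ((hf k).sub ham).enorm) (fun k => Eventually.of_forall fun x => ?_) ?_
      (Eventually.of_forall fun x => ?_)
    · by_cases hx : x ∈ closedBall 0 R
      · rw [indicator_of_mem hx, Pi.one_apply]
        change ‖f k x - a x‖ₑ ≤ 1
        rw [Real.enorm_eq_ofReal_abs, ENNReal.ofReal_le_one, abs_le]
        have h1 := hf01 k x
        have h2 := ha01 x
        constructor <;> linarith [h1.1, h1.2, h2.1, h2.2]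
      · simp [hf0 k x hx, ha0 x hx]
    · rw [lintegral_indicator_one measurableSet_closedBall]
      exact measure_closedBall_lt_top.ne
    · simpa using ((ha x).sub_const (a x)).enorm
  simpa using key

/-- Compactness for sets of uniformly bounded perimeter in a bounded region. -/
theorem exists_subseq_tendsto_indicator_ae
    {E : ℕ → Set (EuclideanSpace ℝ (Fin n))} (hEm : ∀ k, MeasurableSet (E k)) {R : ℝ}
    (hER : ∀ k, E k ⊆ closedBall 0 R) {L : ℝ≥0∞} (hL : L ≠ ⊤) (hper : ∀ k, per (E k) ≤ L) :
    ∃ (σ : ℕ → ℕ) (F : Set (EuclideanSpace ℝ (Fin n))), StrictMono σ ∧ MeasurableSet F ∧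
      ∀ᵐ x, Tendsto (fun k => (E (σ k)).indicator (1 : EuclideanSpace ℝ (Fin n) → ℝ) x) atTop
        (𝓝 (F.indicator 1 x)) := by
  obtain ⟨σ, hσ, hweak⟩ := exists_subseq_tendsto_measureReal_inter hEm hER
  have hfin : ∀ k, volume (E k) ≠ ⊤ := fun k =>
    ((measure_mono (hER k)).trans_lt measure_closedBall_lt_top).ne
  have hbdd : ∀ k, Bornology.IsBounded (E k) := fun k => isBounded_closedBall.subset (hER k)
  let f : ℕ → EuclideanSpace ℝ (Fin n) → ℝ := fun k => (E (σ k)).indicator 1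
  have hfm : ∀ k, Measurable (f k) := fun k => measurable_one.indicator (hEm _)
  have hclose : ∀ δ : ℝ, 0 < δ → ∃ a : EuclideanSpace ℝ (Fin n) → ℝ, Measurable a ∧
      ∀ᶠ k in atTop, ∫⁻ x, ‖f k x - a x‖ₑ ≤ ENNReal.ofReal (δ * L.toReal) + ENNReal.ofReal δ := by
    intro δ hδ
    obtain ⟨a, ham, ha⟩ := exists_tendsto_lintegral_enorm_sub
      (f := fun k => ballDensity (E (σ k)) δ) (fun k => measurable_ballDensity (hEm _) δ)
      (fun k => ballDensity_mem_Icc _ hδ) (fun k x => ballDensity_eq_zero (hER _)) (fun x => by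
        obtain ⟨l, hl⟩ := hweak (ball x δ) measurableSet_ball measure_ball_lt_top.ne
        exact ⟨_, hl.const_mul _⟩)
    refine ⟨a, ham, ?_⟩
    filter_upwards [ha.eventually_le_const (ENNReal.ofReal_pos.2 hδ)] with k hk
    calc ∫⁻ x, ‖f k x - a x‖ₑ
        ≤ ∫⁻ x, (‖f k x - ballDensity (E (σ k)) δ x‖ₑ + ‖ballDensity (E (σ k)) δ x - a x‖ₑ) := by
          refine lintegral_mono fun x => ?_
          rw [← sub_add_sub_cancel (f k x) (ballDensity (E (σ k)) δ x) (a x)]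
          exact enorm_add_le _ _
      _ = (∫⁻ x, ‖f k x - ballDensity (E (σ k)) δ x‖ₑ) +
            ∫⁻ x, ‖ballDensity (E (σ k)) δ x - a x‖ₑ :=
          lintegral_add_left ((hfm k).sub (measurable_ballDensity (hEm _) δ)).enorm _
      _ ≤ _ := by
          refine add_le_add ?_ hk
          refine (lintegral_enorm_sub_ballDensity_le (hEm _) (hbdd _)
            ((hper _).trans_lt hL.lt_top).ne hδ).trans ?_
          refine ENNReal.ofReal_le_ofReal ?_
          gcongr
          exact hper _
  let u : ℕ → Lp ℝ 1 (volume : Measure (EuclideanSpace ℝ (Fin n))) := fun k =>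
    indicatorConstLp 1 (hEm (σ k)) (hfin (σ k)) (1 : ℝ)
  have hu : ∀ k, u k =ᵐ[volume] f k := fun k => indicatorConstLp_coeFn
  have hedist : ∀ j k, edist (u j) (u k) = ∫⁻ x, ‖f j x - f k x‖ₑ := fun j k => by
    rw [Lp.edist_def, eLpNorm_one_eq_lintegral_enorm]
    refine lintegral_congr_ae ?_
    filter_upwards [hu j, hu k] with x h1 h2
    simp [h1, h2]
  have hcauchy : CauchySeq u := by
    refine EMetric.cauchySeq_iff.2 fun ε hε => ?_
    obtain ⟨η, hη, hηε⟩ : ∃ η : ℝ, 0 < η ∧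
        2 * (ENNReal.ofReal (η * L.toReal) + ENNReal.ofReal η) < ε := by
      have ht : Tendsto (fun η : ℝ => 2 * (ENNReal.ofReal (η * L.toReal) + ENNReal.ofReal η))
          (𝓝[>] 0) (𝓝 0) := by
        have hc : Continuous fun η : ℝ =>
            2 * (ENNReal.ofReal (η * L.toReal) + ENNReal.ofReal η) := by
          refine ENNReal.continuous_const_mul (by simp) |>.comp ?_
          exact (ENNReal.continuous_ofReal.comp (continuous_id.mul continuous_const)).add
            ENNReal.continuous_ofReal
        simpa using (hc.tendsto 0).mono_left nhdsWithin_le_nhds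
      obtain ⟨η, h1, h2⟩ := ((ht.eventually_lt_const hε).and self_mem_nhdsWithin).exists
      exact ⟨η, h2, h1⟩
    obtain ⟨a, ham, ha⟩ := hclose η hη
    obtain ⟨N, hN⟩ := eventually_atTop.1 ha
    refine ⟨N, fun j hj k hk => lt_of_le_of_lt ?_ hηε⟩
    rw [hedist, two_mul]
    calc ∫⁻ x, ‖f j x - f k x‖ₑ ≤ ∫⁻ x, (‖f j x - a x‖ₑ + ‖f k x - a x‖ₑ) := by
          refine lintegral_mono fun x => ?_
          rw [← sub_sub_sub_cancel_right (f j x) (f k x) (a x)]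
          exact enorm_sub_le
      _ = (∫⁻ x, ‖f j x - a x‖ₑ) + ∫⁻ x, ‖f k x - a x‖ₑ :=
          lintegral_add_left ((hfm j).sub ham).enorm _
      _ ≤ _ := add_le_add (hN j hj) (hN k hk)
  obtain ⟨U, hU⟩ := cauchySeq_tendsto_of_complete hcauchy
  obtain ⟨τ, hτ, hae⟩ := (tendstoInMeasure_of_tendsto_Lp hU).exists_seq_tendsto_ae
  refine ⟨σ ∘ τ, {x | U x = 1}, hσ.comp hτ,
    (Lp.stronglyMeasurable U).measurable (measurableSet_singleton 1), ?_⟩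
  filter_upwards [hae, ae_all_iff.2 hu] with x hx hux
  have hx' : Tendsto (fun k => f (τ k) x) atTop (𝓝 (U x)) := hx.congr fun k => hux (τ k)
  have hmem : U x ∈ ({0, 1} : Set ℝ) := by
    refine (Set.toFinite _).isClosed.mem_of_tendsto hx' (Eventually.of_forall fun k => ?_)
    by_cases h : x ∈ E (σ (τ k)) <;> simp [f, h]
  have hUx : {x | U x = 1}.indicator (1 : EuclideanSpace ℝ (Fin n) → ℝ) x = U x := by
    rcases hmem with h | h
    · simp [indicator, h]
    · rw [mem_singleton_iff] at h
      simp [indicator, h]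
  rw [hUx]
  exact hx'

theorem tendsto_setIntegral_of_tendsto_indicator_ae {E : ℕ → Set (EuclideanSpace ℝ (Fin n))}
    {F : Set (EuclideanSpace ℝ (Fin n))} (hEm : ∀ k, MeasurableSet (E k)) (hF : MeasurableSet F)
    (h : ∀ᵐ x, Tendsto (fun k => (E k).indicator (1 : EuclideanSpace ℝ (Fin n) → ℝ) x) atTop
      (𝓝 (F.indicator 1 x))) {g : EuclideanSpace ℝ (Fin n) → ℝ} (hg : Integrable g) :
    Tendsto (fun k => ∫ x in E k, g x) atTop (𝓝 (∫ x in F, g x)) := by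
  simp only [← integral_indicator (hEm _), ← integral_indicator hF]
  refine tendsto_integral_of_dominated_convergence (fun x => ‖g x‖)
    (fun k => (hg.indicator (hEm k)).aestronglyMeasurable) hg.norm
    (fun k => Eventually.of_forall fun x => norm_indicator_le_norm_self _ _) ?_
  filter_upwards [h] with x hx
  have : ∀ A : Set (EuclideanSpace ℝ (Fin n)),
      A.indicator g x = A.indicator (1 : EuclideanSpace ℝ (Fin n) → ℝ) x * g x := fun A => by
    by_cases hA : x ∈ A <;> simp [hA]
  simp only [this]
  exact hx.mul_const _

theorem per_le_of_tendsto_indicator_ae {E : ℕ → Set (EuclideanSpace ℝ (Fin n))}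
    {F : Set (EuclideanSpace ℝ (Fin n))} (hEm : ∀ k, MeasurableSet (E k)) (hF : MeasurableSet F)
    (h : ∀ᵐ x, Tendsto (fun k => (E k).indicator (1 : EuclideanSpace ℝ (Fin n) → ℝ) x) atTop
      (𝓝 (F.indicator 1 x))) {L : ℝ≥0∞} (hL : ∀ k, per (E k) ≤ L) : per F ≤ L := by
  refine per_le_iff.2 fun φ hφ hc hb => ?_
  exact le_of_tendsto' (ENNReal.tendsto_ofReal (tendsto_setIntegral_of_tendsto_indicator_ae hEm hF h
    (integrable_vecDiv hφ hc))) fun k => per_le_iff.1 (hL k) φ hφ hc hb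

theorem exists_volume_maximal_of_per_le {K : Set (EuclideanSpace ℝ (Fin n))} (hK : IsCompact K)
    {L : ℝ≥0∞} (hL : L ≠ ⊤) :
    ∃ E, MeasurableSet E ∧ E ⊆ K ∧ per E ≤ L ∧
      ∀ E', MeasurableSet E' → E' ⊆ K → per E' ≤ L → volume E' ≤ volume E := by
  let S : Set ℝ≥0∞ := {v | ∃ E, MeasurableSet E ∧ E ⊆ K ∧ per E ≤ L ∧ volume E = v}
  have hS : S.Nonempty := ⟨0, ∅, MeasurableSet.empty, empty_subset _,
    per_le_iff.2 fun φ _ _ _ => by simp, measure_empty⟩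
  obtain ⟨v, -, hv, hvS⟩ := exists_seq_tendsto_sSup hS (OrderTop.bddAbove S)
  choose E hEm hEK hEL hEv using hvS
  obtain ⟨R, hR⟩ := hK.isBounded.subset_closedBall 0
  obtain ⟨σ, F, hσ, hF, hae⟩ :=
    exists_subseq_tendsto_indicator_ae hEm (fun k => (hEK k).trans hR) hL hEL
  have hFK : F ≤ᵐ[volume] K := by
    filter_upwards [hae] with x hx hxF
    by_contra hxK
    have h0 : ∀ k, (E (σ k)).indicator (1 : EuclideanSpace ℝ (Fin n) → ℝ) x = 0 := fun k =>
      indicator_of_notMem (fun h => hxK (hEK _ h)) _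
    simp only [h0, indicator_of_mem (show x ∈ F from hxF), Pi.one_apply] at hx
    exact zero_ne_one (tendsto_nhds_unique tendsto_const_nhds hx)
  have hFE : (F ∩ K : Set _) =ᵐ[volume] F := inter_eventuallyEq_left.2 hFK
  refine ⟨F ∩ K, hF.inter hK.measurableSet, inter_subset_right, ?_, fun E' h1 h2 h3 => ?_⟩
  · rw [per_congr_ae hFE]
    exact per_le_of_tendsto_indicator_ae (fun k => hEm _) hF hae fun k => hEL _
  · have hKfin : volume K ≠ ⊤ := hK.measure_lt_top.ne
    have hvol := tendsto_setIntegral_of_tendsto_indicator_ae (fun k => hEm (σ k)) hF hae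
      (g := K.indicator 1)
      ((integrable_indicator_iff hK.measurableSet).2 (integrableOn_const hKfin))
    have hint : ∀ A : Set (EuclideanSpace ℝ (Fin n)), MeasurableSet A →
        ∫ x in A, K.indicator (1 : EuclideanSpace ℝ (Fin n) → ℝ) x = volume.real (A ∩ K) := by
      intro A hA
      rw [integral_indicator_one hK.measurableSet, measureReal_restrict_apply hK.measurableSet,
        inter_comm]
    have hAfin : ∀ A : Set (EuclideanSpace ℝ (Fin n)), volume (A ∩ K) ≠ ⊤ := fun A =>
      ((measure_mono inter_subset_right).trans_lt hKfin.lt_top).ne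
    rw [hint F hF] at hvol
    simp only [hint _ (hEm _), inter_eq_left.2 (hEK _)] at hvol
    have hvol' := ENNReal.tendsto_ofReal hvol
    rw [ofReal_measureReal (hAfin F)] at hvol'
    have hvE : ∀ k, ENNReal.ofReal (volume.real (E (σ k))) = v (σ k) := fun k => by
      rw [ofReal_measureReal ((measure_mono (hEK _)).trans_lt hKfin.lt_top).ne, hEv]
    simp only [hvE] at hvol'
    rw [tendsto_nhds_unique hvol' (hv.comp hσ.tendsto_atTop)]
    exact le_sSup ⟨E', h1, h2, h3, rfl⟩

end Compactness

section Enlargement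

variable {n : ℕ}

theorem exists_enlargement {G E : Set (EuclideanSpace ℝ (Fin n))} (hn : 2 ≤ n) (hG : IsOpen G)
    (hEm : MeasurableSet E) (hEfin : volume E ≠ ⊤) (hGE : volume (G \ E) ≠ 0) {L : ℝ≥0∞}
    (hL : per E < L) :
    ∃ B ⊆ G, MeasurableSet B ∧ per (E ∪ B) ≤ L ∧ volume E < volume (E ∪ B) := by
  obtain ⟨C, hC0, hC⟩ := exists_per_union_closedBall_le n
  obtain ⟨x, hx, hpos⟩ := exists_mem_forall_mem_nhdsWithin_pos_measure hGE
  obtain ⟨r₀, hr₀, hball⟩ := nhds_basis_closedBall.mem_iff.1 (hG.mem_nhds hx.1)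
  have ht : Tendsto (fun r : ℝ => per E + ENNReal.ofReal (C * r ^ (n - 1))) (𝓝[>] 0)
      (𝓝 (per E)) := by
    have hc : Continuous fun r : ℝ => per E + ENNReal.ofReal (C * r ^ (n - 1)) :=
      continuous_const.add (ENNReal.continuous_ofReal.comp (by fun_prop))
    have := (hc.tendsto 0).mono_left (nhdsWithin_le_nhds (s := Ioi 0))
    simpa [zero_pow (show n - 1 ≠ 0 by omega)] using this
  obtain ⟨r, ⟨hr1, hr2⟩, hr0⟩ := ((ht.eventually_lt_const hL).and
    (mem_nhdsWithin_of_mem_nhds (Iio_mem_nhds hr₀)) |>.and self_mem_nhdsWithin).exists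
  have hr0' : 0 < r := hr0
  refine ⟨closedBall x r, (closedBall_subset_closedBall (le_of_lt hr2)).trans hball,
    measurableSet_closedBall, (hC E x r hEm hr0').trans hr1.le, ?_⟩
  have hD : 0 < volume (closedBall x r \ E) := by
    refine (hpos (closedBall x r ∩ (G \ E)) (inter_mem
      (mem_nhdsWithin_of_mem_nhds (closedBall_mem_nhds x hr0')) self_mem_nhdsWithin)).trans_le ?_
    exact measure_mono fun y hy => ⟨hy.1, hy.2.2⟩
  rw [← union_sdiff_self, measure_union disjoint_sdiff_right
    (measurableSet_closedBall.diff hEm)]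
  exact ENNReal.lt_add_right hEfin hD.ne'

end Enlargement

end Perimeter

/-- Existence in bounded subregions, part i): for every `L ∈ [0, Per(G))` there exists a
volume-maximal subset of `cl(G)` with perimeter `L`. -/
theorem existence_in_bounded_subregions (n : ℕ) (hn : 2 ≤ n)
    (G : Set (EuclideanSpace ℝ (Fin n))) (hGopen : IsOpen G)
    (hGnull : volume (frontier G) = 0) (hGbdd : Bornology.IsBounded G)
    (L : ℝ≥0∞) (hL : L < per G) :
    ∃ E : Set (EuclideanSpace ℝ (Fin n)), MeasurableSet E ∧ E ⊆ closure G ∧ per E = L ∧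
      ∀ E' : Set (EuclideanSpace ℝ (Fin n)), MeasurableSet E' → E' ⊆ closure G →
        per E' = L → volume E' ≤ volume E := by
  obtain ⟨E, hEm, hEG, hEL, hmax⟩ :=
    exists_volume_maximal_of_per_le hGbdd.isCompact_closure hL.ne_top
  refine ⟨E, hEm, hEG, hEL.antisymm (le_of_not_gt fun hlt => ?_),
    fun E' h1 h2 h3 => hmax E' h1 h2 h3.le⟩
  have hEfin : volume E ≠ ⊤ :=
    ((measure_mono hEG).trans_lt hGbdd.isCompact_closure.measure_lt_top).ne
  have hGE : volume (G \ E) ≠ 0 := fun h0 => by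
    have hle : E ≤ᵐ[volume] G := ae_le_set.2 <| measure_mono_null (fun x hx => by
      rw [frontier, hGopen.interior_eq]
      exact ⟨hEG hx.1, hx.2⟩) hGnull
    have heq : E =ᵐ[volume] G := hle.antisymm (ae_le_set.2 h0)
    exact (hlt.trans hL).ne (per_congr_ae heq)
  obtain ⟨B, hBG, hBm, hper, hvol⟩ := exists_enlargement hn hGopen hEm hEfin hGE hlt
  exact hvol.not_ge (hmax _ (hEm.union hBm)
    (Set.union_subset hEG (hBG.trans subset_closure)) hper)
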